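/- Let P be a standard parabolic submonoid of M and let s be an atom of M not in P. Then the element v_{s,P} defined by Δ_{P_s} = Δ_P v_{s,P} is a P-ribbon: v_{s,P} is P-reduced and P^{v_{s,P}} is defined. -/

import Mathlib

/-!
Common setting: Garside monoids, standard parabolic submonoids, heads,
ribbons, following Digne–Michel, "Ribbons in Garside monoids".
-/

namespace GarsidePaper

variable {M : Type*}

/-- `a` left-divides `b` : `b = a * c` for some `c`. -/
def LDvd [Monoid M] (a b : M) : Prop := ∃ c, b = a * c

/-- `a` right-divides `b` : `b = c * a` for some `c`. -/
def RDvd [Monoid M] (a b : M) : Prop := ∃ c, b = c * a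

/-- `a` is a factor of `b` : `a` left-divides a right-divisor of `b`. -/
def IsFactor [Monoid M] (a b : M) : Prop := ∃ c, LDvd a c ∧ RDvd c b

/-- A Garside structure on a (left- and right-) cancellative monoid `M`:
left/right gcds and lcms, Noetherianity, and a Garside element `Δ`. -/
structure GarsideStruct (M : Type*) [CancelMonoid M] where
  /-- left-gcd : gcd for the left-divisibility order -/
  lgcd : M → M → M
  lgcd_dvd_left : ∀ a b, LDvd (lgcd a b) a
  lgcd_dvd_right : ∀ a b, LDvd (lgcd a b) b
  lgcd_greatest : ∀ a b d, LDvd d a → LDvd d b → LDvd d (lgcd a b)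
  /-- right-lcm : lcm for the left-divisibility order -/
  rlcm : M → M → M
  ldvd_rlcm_left : ∀ a b, LDvd a (rlcm a b)
  ldvd_rlcm_right : ∀ a b, LDvd b (rlcm a b)
  rlcm_least : ∀ a b m, LDvd a m → LDvd b m → LDvd (rlcm a b) m
  /-- right-gcd : gcd for the right-divisibility order -/
  rgcd : M → M → M
  rgcd_dvd_left : ∀ a b, RDvd (rgcd a b) a
  rgcd_dvd_right : ∀ a b, RDvd (rgcd a b) b
  rgcd_greatest : ∀ a b d, RDvd d a → RDvd d b → RDvd d (rgcd a b)
  /-- left-lcm : lcm for the right-divisibility order -/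
  llcm : M → M → M
  rdvd_llcm_left : ∀ a b, RDvd a (llcm a b)
  rdvd_llcm_right : ∀ a b, RDvd b (llcm a b)
  llcm_least : ∀ a b m, RDvd a m → RDvd b m → RDvd (llcm a b) m
  /-- Noetherian: no infinite sequence where each term is a proper factor
  of the previous one. -/
  noetherian : WellFounded (fun a b : M => IsFactor a b ∧ a ≠ b)
  /-- the Garside element -/
  Δ : M
  /-- the left- and right-divisors of `Δ` coincide -/
  delta_balanced : ∀ a : M, LDvd a Δ ↔ RDvd a Δ
  /-- the divisors of `Δ` generate `M` -/
  delta_generates : Submonoid.closure {a : M | LDvd a Δ} = ⊤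

variable [CancelMonoid M]

/-- An atom: an element with no proper nontrivial divisor (factor). -/
def IsAtom' (a : M) : Prop := a ≠ 1 ∧ ∀ b : M, IsFactor b a → b = 1 ∨ b = a

/-- A standard parabolic submonoid: a submonoid closed under factors in which
every element of `M` has a maximal left-divisor (the left `P`-head) and a
maximal right-divisor (the right `P`-head) lying in `P`. -/
structure IsStdParabolic (P : Submonoid M) : Prop where
  factor_closed : ∀ a b : M, b ∈ P → IsFactor a b → a ∈ P
  exists_left_head : ∀ g : M, ∃ h, h ∈ P ∧ LDvd h g ∧
    ∀ h', h' ∈ P → LDvd h' g → LDvd h' h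
  exists_right_head : ∀ g : M, ∃ h, h ∈ P ∧ RDvd h g ∧
    ∀ h', h' ∈ P → RDvd h' g → RDvd h' h

/-- `h` is the left `P`-head `H_P g` of `g` : the maximal left-divisor of `g`
lying in `P`. -/
def IsLeftHead (P : Set M) (g h : M) : Prop :=
  h ∈ P ∧ LDvd h g ∧ ∀ h', h' ∈ P → LDvd h' g → LDvd h' h

/-- `h` is the right `P`-head of `g` : the maximal right-divisor of `g`
lying in `P`. -/
def IsRightHead (P : Set M) (g h : M) : Prop :=
  h ∈ P ∧ RDvd h g ∧ ∀ h', h' ∈ P → RDvd h' g → RDvd h' h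

/-- `g` is `P`-reduced : `H_P g = 1`, i.e. the only left-divisor of `g`
lying in `P` is `1`. -/
def PReduced (P : Set M) (g : M) : Prop := ∀ h ∈ P, LDvd h g → h = 1

/-- `P ^ g` is defined: `p ^ g` is defined (`g ≼ p * g`) for every `p ∈ P`. -/
def ConjSetDef (P : Set M) (g : M) : Prop := ∀ p ∈ P, LDvd g (p * g)

/-- The set `P ^ g = { p ^ g : p ∈ P }`, where `p ^ g` is the unique `c`
with `p * g = g * c`. -/
def conjSet (P : Set M) (g : M) : Set M := {c : M | ∃ p ∈ P, p * g = g * c}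

/-- A `P`-ribbon: a `P`-reduced element `g` such that `P ^ g` is defined. -/
def IsRibbon (P : Set M) (g : M) : Prop := PReduced P g ∧ ConjSetDef P g

/-- `P` is the smallest standard parabolic submonoid containing `S₁`. -/
def IsSmallestParabolicContaining (S₁ : Set M) (P : Submonoid M) : Prop :=
  IsStdParabolic P ∧ S₁ ⊆ (P : Set M) ∧
    ∀ Q : Submonoid M, IsStdParabolic Q → S₁ ⊆ (Q : Set M) → P ≤ Q

/-- Assumption 1: for any set `S₁` of atoms, the right-lcm of `S₁` is the
Garside element `Δ_{P₁} = H_{P₁}(Δ)` of the smallest standard parabolic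
submonoid `P₁` containing `S₁`. -/
def Assumption1 (G : GarsideStruct M) : Prop :=
  ∀ S₁ : Set M, (∀ s ∈ S₁, IsAtom' s) →
    ∀ P₁ : Submonoid M, IsSmallestParabolicContaining S₁ P₁ →
      ∀ d : M, IsLeftHead (P₁ : Set M) G.Δ d →
        (∀ s ∈ S₁, LDvd s d) ∧ ∀ m : M, (∀ s ∈ S₁, LDvd s m) → LDvd d m

/-- Assumption 2: some (positive) power of `Δ` is central. -/
def Assumption2 (G : GarsideStruct M) : Prop :=
  ∃ n : ℕ, 0 < n ∧ ∀ x : M, G.Δ ^ n * x = x * G.Δ ^ n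

/-- `v = v_{s,P}` : the element defined by `Δ_{P_s} = Δ_P * v`, where `P_s`
is the smallest standard parabolic submonoid containing `P` and `s`. -/
def IsVsp (G : GarsideStruct M) (P : Submonoid M) (s v : M) : Prop :=
  ∃ Ps : Submonoid M, IsSmallestParabolicContaining ((P : Set M) ∪ {s}) Ps ∧
    ∃ dP dPs : M, IsLeftHead (P : Set M) G.Δ dP ∧
      IsLeftHead (Ps : Set M) G.Δ dPs ∧ dPs = dP * v

theorem IsFactor.of_ldvd {a b : M} (h : LDvd a b) : IsFactor a b :=
  ⟨b, h, 1, (one_mul b).symm⟩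

theorem IsFactor.of_rdvd {a b : M} (h : RDvd a b) : IsFactor a b :=
  ⟨a, ⟨1, (mul_one a).symm⟩, h⟩

theorem LDvd.trans {a b c : M} (hab : LDvd a b) (hbc : LDvd b c) : LDvd a c := by
  obtain ⟨x, rfl⟩ := hab
  obtain ⟨y, rfl⟩ := hbc
  exact ⟨x * y, mul_assoc a x y⟩

theorem IsStdParabolic.mem_of_mul_mem {P : Submonoid M} (hP : IsStdParabolic P) {x y : M}
    (h : x * y ∈ P) : x ∈ P ∧ y ∈ P :=
  ⟨hP.factor_closed _ _ h (.of_ldvd ⟨y, rfl⟩), hP.factor_closed _ _ h (.of_rdvd ⟨x, rfl⟩)⟩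

namespace GarsideStruct

theorem eq_of_isFactor_of_isFactor (G : GarsideStruct M) {a b : M} (hab : IsFactor a b)
    (hba : IsFactor b a) : a = b := by
  by_contra hne
  exact G.noetherian.asymmetric a b ⟨hab, hne⟩ ⟨hba, fun h => hne h.symm⟩

theorem eq_one_of_mul_eq_one (G : GarsideStruct M) {a b : M} (h : a * b = 1) : a = 1 :=
  G.eq_of_isFactor_of_isFactor (.of_ldvd ⟨b, h.symm⟩) (.of_ldvd ⟨a, (one_mul a).symm⟩)

/-- The left head of `Δ` in a standard parabolic submonoid is also its right head. -/
theorem isRightHead_of_isLeftHead (G : GarsideStruct M) {P : Submonoid M} (hP : IsStdParabolic P)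
    {d : M} (hd : IsLeftHead (P : Set M) G.Δ d) : IsRightHead (P : Set M) G.Δ d := by
  obtain ⟨hdP, hdΔ, hdmax⟩ := hd
  obtain ⟨e, heP, heΔ, hemax⟩ := hP.exists_right_head G.Δ
  have hde : RDvd d e := hemax d hdP ((G.delta_balanced d).1 hdΔ)
  have hed : LDvd e d := hdmax e heP ((G.delta_balanced e).2 heΔ)
  obtain rfl : d = e := G.eq_of_isFactor_of_isFactor (.of_rdvd hde) (.of_ldvd hed)
  exact ⟨heP, heΔ, hemax⟩

/-- The simple elements of `P` can be conjugated by `Δ_P`. -/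
theorem exists_mul_head_eq (G : GarsideStruct M) {P : Submonoid M} (hP : IsStdParabolic P)
    {d : M} (hd : IsLeftHead (P : Set M) G.Δ d) {p : M} (hp : p ∈ P) (hpΔ : LDvd p G.Δ) :
    ∃ q, p * d = d * q := by
  obtain ⟨x, hx⟩ := hd.2.2 p hp hpΔ
  have hxP : x ∈ P := (hP.mem_of_mul_mem (hx ▸ hd.1 : p * x ∈ P)).2
  have hxd : RDvd x d := ⟨p, hx⟩
  obtain ⟨y, hy⟩ := (G.isRightHead_of_isLeftHead hP hd).2.1
  have hxΔ : LDvd x G.Δ := (G.delta_balanced x).2 ⟨y * p, by rw [hy, hx, mul_assoc]⟩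
  obtain ⟨q, hq⟩ := hd.2.2 x hxP hxΔ
  refine ⟨q, ?_⟩
  calc p * d = p * (x * q) := by rw [← hq]
    _ = d * q := by rw [← mul_assoc, ← hx]

/-- Every simple element of `P` is the conjugate by `Δ_P` of a simple element of `P`. -/
theorem exists_head_mul_eq (G : GarsideStruct M) {P : Submonoid M} (hP : IsStdParabolic P)
    {d : M} (hd : IsLeftHead (P : Set M) G.Δ d) {p : M} (hp : p ∈ P) (hpΔ : LDvd p G.Δ) :
    ∃ q ∈ P, LDvd q G.Δ ∧ q * d = d * p := by
  have hr := G.isRightHead_of_isLeftHead hP hd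
  obtain ⟨x, hx⟩ := hr.2.2 p hp ((G.delta_balanced p).1 hpΔ)
  have hxP : x ∈ P := (hP.mem_of_mul_mem (hx ▸ hd.1 : x * p ∈ P)).1
  have hxΔ : LDvd x G.Δ := LDvd.trans ⟨p, hx⟩ hd.2.1
  obtain ⟨q, hq⟩ := hr.2.2 x hxP ((G.delta_balanced x).1 hxΔ)
  have hqP : q ∈ P := (hP.mem_of_mul_mem (hq ▸ hd.1 : q * x ∈ P)).1
  refine ⟨q, hqP, LDvd.trans ⟨x, hq⟩ hd.2.1, ?_⟩
  calc q * d = q * (x * p) := by rw [← hx]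
    _ = d * p := by rw [← mul_assoc, ← hq]

/-- Conjugation by `v` is defined on `P` as soon as it is defined on the simple elements of `P`. -/
theorem conjSetDef_of_simple (G : GarsideStruct M) {P : Submonoid M} (hP : IsStdParabolic P)
    {v : M} (h : ∀ p ∈ P, LDvd p G.Δ → LDvd v (p * v)) : ConjSetDef (P : Set M) v := by
  intro p hp
  have hmem : p ∈ Submonoid.closure {a : M | LDvd a G.Δ} := by
    rw [G.delta_generates]
    exact Submonoid.mem_top p
  induction hmem using Submonoid.closure_induction with
  | mem x hx => exact h x hp hx
  | one => exact ⟨1, by rw [one_mul, mul_one]⟩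
  | mul x y _ _ ihx ihy =>
    obtain ⟨hxP, hyP⟩ := hP.mem_of_mul_mem hp
    obtain ⟨a, ha⟩ := ihx hxP
    obtain ⟨b, hb⟩ := ihy hyP
    exact ⟨a * b, by rw [mul_assoc, hb, ← mul_assoc, ha, mul_assoc]⟩

end GarsideStruct

/-- for a standard parabolic submonoid `P` and an atom `s ∉ P`,
the element `v_{s,P}` defined by `Δ_{P_s} = Δ_P * v_{s,P}` is a `P`-ribbon. -/
theorem statement1 (G : GarsideStruct M) (hA : Assumption1 G)
    (P : Submonoid M) (hP : IsStdParabolic P)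
    (s : M) (hs : IsAtom' s) (hsP : s ∉ P)
    (v : M) (hv : IsVsp G P s v) :
    IsRibbon (P : Set M) v := by
  obtain ⟨Q, ⟨hQ, hPQ, -⟩, d, e, hd, he, rfl⟩ := hv
  refine ⟨?_, G.conjSetDef_of_simple hP ?_⟩
  · rintro h hh ⟨x, rfl⟩
    have hdh : LDvd (d * h) G.Δ := LDvd.trans ⟨x, (mul_assoc d h x).symm⟩ he.2.1
    obtain ⟨c, hc⟩ := hd.2.2 _ (P.mul_mem hd.1 hh) hdh
    refine G.eq_one_of_mul_eq_one (b := c) (mul_left_cancel (a := d) ?_)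
    rw [← mul_assoc, ← hc, mul_one]
  · intro p hp hpΔ
    obtain ⟨q, hq, hqΔ, hqd⟩ := G.exists_head_mul_eq hP hd hp hpΔ
    obtain ⟨r, hr⟩ := G.exists_mul_head_eq hQ he (hPQ (Or.inl hq)) hqΔ
    refine ⟨r, mul_left_cancel (a := d) ?_⟩
    rw [← mul_assoc, ← hqd, mul_assoc, hr, mul_assoc]

end GarsidePaper
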